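/- Let k ≥ 1 and let ν be a probability measure on (0,∞)^k. Then for every x ∈ (0,∞)^k, ∫_{(0,∞)^k} f_ν(g) Ψ_g(x) dg = f_{νQ}(x), where νQ is the probability measure A ↦ ∫ Σ_{τ ∈ S(0..k)} w_τ(λ) 1_{F_τ(λ) ∈ A} dν(λ). In words: the gaps operator of iterated Brownian motion maps the mixture of products of exponential densities with parameter law ν to the mixture with parameter law νQ. -/

import Mathlib

open MeasureTheory ProbabilityTheory Real Finset

noncomputable section

/-- Density of the centred Gaussian law with variance `g`. -/
def Phi (g y : ℝ) : ℝ := (Real.sqrt (2 * Real.pi * g))⁻¹ * Real.exp (-(y ^ 2) / (2 * g))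

/-- Partial sums: `xbar x j = x 0 + ⋯ + x (j-1)` (i.e. `x̄_j`), with `x̄_0 = 0`. -/
def xbar {k : ℕ} (x : Fin k → ℝ) (j : Fin (k + 1)) : ℝ :=
  ∑ i : Fin k, if (i : ℕ) < (j : ℕ) then x i else 0

/-- The density `Ψ_g` of the gaps sequence of iterated Brownian motion. -/
def Psi {k : ℕ} (g x : Fin k → ℝ) : ℝ :=
  ∑ τ : Equiv.Perm (Fin (k + 1)), ∏ i : Fin k,
    Phi (g i) (xbar x (τ i.succ) - xbar x (τ i.castSucc))

/-- The gaps sequence of a `(k+1)`-tuple of reals. -/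
def gaps {k : ℕ} (ℓ : Fin (k + 1) → ℝ) : Fin k → ℝ :=
  fun i => ℓ (Tuple.sort ℓ i.succ) - ℓ (Tuple.sort ℓ i.castSucc)

/-- `E_{τ,i}`: the set of `j ∈ {1,…,k}` with `min(τ(j-1),τ(j)) < i ≤ max(τ(j-1),τ(j))`
(index `j : Fin k` represents `j+1`, `i : Fin k` represents `i+1`). -/
def Eset {k : ℕ} (τ : Equiv.Perm (Fin (k + 1))) (i : Fin k) : Finset (Fin k) :=
  Finset.univ.filter (fun j : Fin k =>
    min ((τ j.castSucc : Fin (k + 1)) : ℕ) ((τ j.succ : Fin (k + 1)) : ℕ) < (i : ℕ) + 1 ∧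
      (i : ℕ) + 1 ≤ max ((τ j.castSucc : Fin (k + 1)) : ℕ) ((τ j.succ : Fin (k + 1)) : ℕ))

/-- `F_{τ,i}(λ) = Σ_{j ∈ E_{τ,i}} √(2 λ_j)`. -/
def F {k : ℕ} (τ : Equiv.Perm (Fin (k + 1))) (i : Fin k) (l : Fin k → ℝ) : ℝ :=
  ∑ j ∈ Eset τ i, Real.sqrt (2 * l j)

/-- `w_τ(λ) = 2^{-k} Π_i √(2 λ_i) / F_{τ,i}(λ)`. -/
def w {k : ℕ} (τ : Equiv.Perm (Fin (k + 1))) (l : Fin k → ℝ) : ℝ :=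
  (2 : ℝ)⁻¹ ^ k * ∏ i : Fin k, Real.sqrt (2 * l i) / F τ i l

/-- The mixture of products of exponential densities with parameter law `ν`:
`f_ν(x) = ∫ Π_i λ_i e^{−λ_i x_i} dν(λ)`. -/
def fmix {k : ℕ} (ν : Measure (Fin k → ℝ)) (x : Fin k → ℝ) : ℝ :=
  ∫ l, ∏ i : Fin k, l i * Real.exp (-(l i * x i)) ∂ν

/-- The Markov kernel `Q(λ, ·) = Σ_{τ ∈ S(0..k)} w_τ(λ) δ_{F_τ(λ)}` at the parameter
level; `ν.bind Qker` is the measure `νQ : A ↦ ∫ Σ_τ w_τ(λ) 1_{F_τ(λ) ∈ A} dν(λ)`. -/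
def Qker {k : ℕ} (l : Fin k → ℝ) : Measure (Fin k → ℝ) :=
  ∑ τ : Equiv.Perm (Fin (k + 1)),
    ENNReal.ofReal (w τ l) • Measure.dirac (fun i => F τ i l)

open Filter Topology Set in
lemma integral_Ioi_zero_of_hasDerivAt_of_nonneg {f f' : ℝ → ℝ} {a b : ℝ}
    (hderiv : ∀ x ∈ Ioi (0 : ℝ), HasDerivAt f (f' x) x) (hpos : ∀ x ∈ Ioi (0 : ℝ), 0 ≤ f' x)
    (h0 : Tendsto f (𝓝[>] 0) (𝓝 a)) (htop : Tendsto f atTop (𝓝 b)) :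
    IntegrableOn f' (Ioi 0) ∧ ∫ x in Ioi 0, f' x = b - a := by
  have hd : ∀ x ∈ Ioi (0 : ℝ), HasDerivAt (Function.update f 0 a) (f' x) x := fun x hx =>
    (hderiv x hx).congr_of_eventuallyEq <| by
      filter_upwards [eventually_ne_nhds (ne_of_gt hx)] with z hz
      exact Function.update_of_ne hz _ _
  have hc : ContinuousWithinAt (Function.update f 0 a) (Ici 0) 0 := by
    rwa [continuousWithinAt_update_same, Ici_sdiff_left]
  have ht : Tendsto (Function.update f 0 a) atTop (𝓝 b) := htop.congr' <| by
    filter_upwards [eventually_ne_atTop 0] with z hz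
    exact (Function.update_of_ne hz _ _).symm
  refine ⟨integrableOn_Ioi_deriv_of_nonneg hc hd hpos ht, ?_⟩
  simpa using integral_Ioi_of_hasDerivAt_of_nonneg hc hd hpos ht

/-- The unnormalised error function. -/
def gaussPrimitive (t : ℝ) : ℝ := ∫ s in (0 : ℝ)..t, Real.exp (-s ^ 2)

lemma hasDerivAt_gaussPrimitive (t : ℝ) :
    HasDerivAt gaussPrimitive (Real.exp (-t ^ 2)) t :=
  have h : Continuous fun s : ℝ => Real.exp (-s ^ 2) := by fun_prop
  intervalIntegral.integral_hasDerivAt_right (h.intervalIntegrable _ _)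
    (h.stronglyMeasurableAtFilter _ _) h.continuousAt

lemma gaussPrimitive_neg (t : ℝ) : gaussPrimitive (-t) = -gaussPrimitive t := by
  have := intervalIntegral.integral_comp_neg (a := 0) (b := t) fun s : ℝ => Real.exp (-s ^ 2)
  simp only [neg_sq, neg_zero] at this
  rw [gaussPrimitive, gaussPrimitive, this, intervalIntegral.integral_symm]

open Filter Topology in
lemma tendsto_gaussPrimitive_atTop : Tendsto gaussPrimitive atTop (𝓝 (√π / 2)) := by
  have hi : Integrable fun s : ℝ => Real.exp (-s ^ 2) := by
    simpa using integrable_exp_neg_mul_sq one_pos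
  have h := intervalIntegral_tendsto_integral_Ioi 0 hi.integrableOn tendsto_id
  have h2 := integral_gaussian_Ioi 1
  simp only [neg_mul, one_mul, div_one] at h2
  rwa [h2] at h

open Filter Topology in
lemma tendsto_gaussPrimitive_atBot : Tendsto gaussPrimitive atBot (𝓝 (-(√π / 2))) := by
  have h := (tendsto_gaussPrimitive_atTop.comp tendsto_neg_atBot_atTop).neg
  refine h.congr fun t => ?_
  simp [gaussPrimitive_neg]

open Filter Topology Set in
lemma integral_exp_neg_mul_sub_div {p c : ℝ} (hp : 0 < p) (hc : 0 < c) :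
    IntegrableOn (fun g => p / √g * Real.exp (-(p ^ 2 * g) - c ^ 2 / g)) (Ioi 0) ∧
      ∫ g in Ioi 0, p / √g * Real.exp (-(p ^ 2 * g) - c ^ 2 / g)
        = √π * Real.exp (-(2 * p * c)) := by
  have hs0 : Tendsto (fun g : ℝ => √g) (𝓝[>] 0) (𝓝[>] 0) := by
    refine tendsto_nhdsWithin_iff.2 ⟨?_, ?_⟩
    · have := (Real.continuous_sqrt.tendsto 0).mono_left (nhdsWithin_le_nhds (s := Ioi 0))
      simpa using this
    · filter_upwards [self_mem_nhdsWithin] with g hg using Real.sqrt_pos.2 hg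
  have hps0 : Tendsto (fun g : ℝ => p * √g) (𝓝[>] 0) (𝓝 0) := by
    simpa using (hs0.mono_right nhdsWithin_le_nhds).const_mul p
  have hcs0 : Tendsto (fun g : ℝ => c / √g) (𝓝[>] 0) atTop :=
    (tendsto_inv_nhdsGT_zero.comp hs0).const_mul_atTop hc
  have hpst : Tendsto (fun g : ℝ => p * √g) atTop atTop :=
    Real.tendsto_sqrt_atTop.const_mul_atTop hp
  have hcst : Tendsto (fun g : ℝ => c / √g) atTop (𝓝 0) :=
    Real.tendsto_sqrt_atTop.const_div_atTop c
  have hu0 : Tendsto (fun g : ℝ => p * √g - c / √g) (𝓝[>] 0) atBot := by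
    simpa [sub_eq_add_neg] using hps0.add_atBot (tendsto_neg_atTop_atBot.comp hcs0)
  have hv0 : Tendsto (fun g : ℝ => p * √g + c / √g) (𝓝[>] 0) atTop := hps0.add_atTop hcs0
  have hut : Tendsto (fun g : ℝ => p * √g - c / √g) atTop atTop := by
    simpa [sub_eq_add_neg] using hpst.atTop_add hcst.neg
  have hvt : Tendsto (fun g : ℝ => p * √g + c / √g) atTop atTop := hpst.atTop_add hcst
  have key := integral_Ioi_zero_of_hasDerivAt_of_nonneg
    (f := fun g => Real.exp (-(2 * p * c)) * gaussPrimitive (p * √g - c / √g) +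
      Real.exp (2 * p * c) * gaussPrimitive (p * √g + c / √g))
    (f' := fun g => p / √g * Real.exp (-(p ^ 2 * g) - c ^ 2 / g))
    ?_ (fun g _ => by positivity)
    (((tendsto_gaussPrimitive_atBot.comp hu0).const_mul _).add
      ((tendsto_gaussPrimitive_atTop.comp hv0).const_mul _))
    (((tendsto_gaussPrimitive_atTop.comp hut).const_mul _).add
      ((tendsto_gaussPrimitive_atTop.comp hvt).const_mul _))
  · refine ⟨key.1, key.2.trans ?_⟩
    ring
  intro g hg
  have hg' : (0 : ℝ) < g := hg
  have hs : 0 < √g := Real.sqrt_pos.2 hg'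
  have hsq : √g ^ 2 = g := Real.sq_sqrt hg'.le
  have hds : HasDerivAt (fun g : ℝ => √g) (1 / (2 * √g)) g := Real.hasDerivAt_sqrt hg'.ne'
  have hdi := (hasDerivAt_const g c).div hds hs.ne'
  have hdu := (hds.const_mul p).sub hdi
  have hdv := (hds.const_mul p).add hdi
  have h1 := ((hasDerivAt_gaussPrimitive _).comp g hdu).const_mul (Real.exp (-(2 * p * c)))
  have h2 := ((hasDerivAt_gaussPrimitive _).comp g hdv).const_mul (Real.exp (2 * p * c))
  refine (h1.add h2).congr_deriv ?_
  simp only [Pi.sub_apply, Pi.add_apply, Pi.div_apply]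
  have e1 : Real.exp (-(2 * p * c)) * Real.exp (-(p * √g - c / √g) ^ 2)
      = Real.exp (-(p ^ 2 * g) - c ^ 2 / g) := by
    rw [← Real.exp_add]; congr 1
    nth_rw 3 4 [← hsq]
    field_simp
    ring
  have e2 : Real.exp (2 * p * c) * Real.exp (-(p * √g + c / √g) ^ 2)
      = Real.exp (-(p ^ 2 * g) - c ^ 2 / g) := by
    rw [← Real.exp_add]; congr 1
    nth_rw 3 4 [← hsq]
    field_simp
    ring
  rw [← mul_assoc, ← mul_assoc, e1, e2]
  field_simp
  ring

open Set in
lemma integral_exp_mul_Phi {l y : ℝ} (hl : 0 < l) (hy : y ≠ 0) :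
    IntegrableOn (fun g => l * Real.exp (-(l * g)) * Phi g y) (Ioi 0) ∧
      ∫ g in Ioi 0, l * Real.exp (-(l * g)) * Phi g y
        = 2⁻¹ * (√(2 * l) * Real.exp (-(√(2 * l) * |y|))) := by
  have hp := Real.sqrt_pos.2 hl
  have hpsq : √l ^ 2 = l := Real.sq_sqrt hl.le
  have h2 : (0 : ℝ) < √2 := by positivity
  have hc : 0 < |y| / √2 := div_pos (abs_pos.2 hy) h2
  obtain ⟨hi, he⟩ := integral_exp_neg_mul_sub_div hp hc
  have heq : EqOn (fun g => √l / √(2 * π) *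
      (√l / √g * Real.exp (-(√l ^ 2 * g) - (|y| / √2) ^ 2 / g)))
      (fun g => l * Real.exp (-(l * g)) * Phi g y) (Ioi 0) := by
    intro g hg
    have hg' : (0 : ℝ) < g := hg
    have hs : 0 < √g := Real.sqrt_pos.2 hg'
    have hpi : 0 < √(2 * π) := by positivity
    simp only [Phi]
    have hexp : Real.exp (-(√l ^ 2 * g) - (|y| / √2) ^ 2 / g)
        = Real.exp (-(l * g)) * Real.exp (-(y ^ 2) / (2 * g)) := by
      rw [← Real.exp_add, hpsq, div_pow, sq_abs, Real.sq_sqrt zero_le_two]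
      congr 1
      field_simp
      ring
    rw [hexp, Real.sqrt_mul (by positivity) g]
    nth_rw 4 [← hpsq]
    field_simp
  refine ⟨IntegrableOn.congr_fun (hi.const_mul _) heq measurableSet_Ioi, ?_⟩
  rw [← setIntegral_congr_fun measurableSet_Ioi heq, integral_const_mul, he,
    Real.sqrt_mul zero_le_two π, Real.sqrt_mul zero_le_two l]
  have hpi : 0 < √π := by positivity
  have hss : √2 * √2 = 2 := Real.mul_self_sqrt zero_le_two
  rw [show 2 * √l * (|y| / √2) = 2 / √2 * √l * |y| by ring, Real.div_sqrt]
  rw [show (2 : ℝ)⁻¹ = (√2)⁻¹ * (√2)⁻¹ by rw [← mul_inv, hss]]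
  field_simp

lemma xbar_sub_of_le {k : ℕ} (x : Fin k → ℝ) {a b : Fin (k + 1)} (hab : a ≤ b) :
    xbar x b - xbar x a
      = ∑ i : Fin k, if (a : ℕ) < (i : ℕ) + 1 ∧ (i : ℕ) + 1 ≤ (b : ℕ) then x i else 0 := by
  have hab' : (a : ℕ) ≤ b := hab
  rw [xbar, xbar, ← Finset.sum_sub_distrib]
  refine Finset.sum_congr rfl fun i _ => ?_
  split_ifs <;> first | omega | simp

lemma abs_xbar_sub {k : ℕ} {x : Fin k → ℝ} (hx : ∀ i, 0 ≤ x i) (a b : Fin (k + 1)) :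
    |xbar x b - xbar x a|
      = ∑ i : Fin k, if min (a : ℕ) (b : ℕ) < (i : ℕ) + 1 ∧ (i : ℕ) + 1 ≤ max (a : ℕ) (b : ℕ)
          then x i else 0 := by
  wlog hab : a ≤ b generalizing a b
  · rw [abs_sub_comm, this b a (le_of_not_ge hab), min_comm, max_comm]
  have hab' : (a : ℕ) ≤ b := hab
  rw [xbar_sub_of_le x hab, min_eq_left hab', max_eq_right hab', abs_of_nonneg]
  exact Finset.sum_nonneg fun i _ => by split_ifs <;> simp [hx]

lemma xbar_strictMono {k : ℕ} {x : Fin k → ℝ} (hx : ∀ i, 0 < x i) : StrictMono (xbar x) := by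
  intro a b hab
  rw [← sub_pos, xbar_sub_of_le x hab.le]
  have hab' : (a : ℕ) < b := hab
  refine Finset.sum_pos' (fun i _ => by split_ifs <;> simp [(hx i).le])
    ⟨⟨a, by omega⟩, Finset.mem_univ _, ?_⟩
  rw [if_pos (by simp only; omega)]
  exact hx _

lemma sum_F_mul {k : ℕ} (τ : Equiv.Perm (Fin (k + 1))) (l : Fin k → ℝ) {x : Fin k → ℝ}
    (hx : ∀ i, 0 ≤ x i) :
    ∑ i, F τ i l * x i
      = ∑ j : Fin k, √(2 * l j) * |xbar x (τ j.succ) - xbar x (τ j.castSucc)| := by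
  simp only [F, Eset, Finset.sum_filter, Finset.sum_mul, abs_xbar_sub hx, Finset.mul_sum]
  rw [Finset.sum_comm]
  refine Finset.sum_congr rfl fun j _ => Finset.sum_congr rfl fun i _ => ?_
  split_ifs <;> simp

lemma Eset_nonempty {k : ℕ} (τ : Equiv.Perm (Fin (k + 1))) (i : Fin k) : (Eset τ i).Nonempty := by
  by_contra h
  have hstep : ∀ j : Fin k,
      ((τ j.castSucc : Fin (k + 1)) : ℕ) ≤ i ↔ ((τ j.succ : Fin (k + 1)) : ℕ) ≤ i := by
    intro j
    by_contra hj
    refine h ⟨j, ?_⟩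
    rw [Eset, Finset.mem_filter]
    refine ⟨Finset.mem_univ _, ?_⟩
    omega
  have hall : ∀ j : Fin (k + 1), ((τ j : Fin (k + 1)) : ℕ) ≤ i ↔ ((τ 0 : Fin (k + 1)) : ℕ) ≤ i :=
    fun j => Fin.induction Iff.rfl (fun j hj => (hstep j).symm.trans hj) j
  have h0 := hall (τ.symm 0)
  have h1 := hall (τ.symm (Fin.last k))
  simp only [Equiv.apply_symm_apply, Fin.val_zero, Fin.val_last] at h0 h1
  omega

lemma F_nonneg {k : ℕ} (τ : Equiv.Perm (Fin (k + 1))) (i : Fin k) (l : Fin k → ℝ) :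
    0 ≤ F τ i l :=
  Finset.sum_nonneg fun _ _ => Real.sqrt_nonneg _

lemma F_pos {k : ℕ} (τ : Equiv.Perm (Fin (k + 1))) (i : Fin k) {l : Fin k → ℝ}
    (hl : ∀ i, 0 < l i) : 0 < F τ i l :=
  Finset.sum_pos (fun j _ => Real.sqrt_pos.2 (mul_pos two_pos (hl j))) (Eset_nonempty τ i)

lemma w_nonneg {k : ℕ} (τ : Equiv.Perm (Fin (k + 1))) (l : Fin k → ℝ) : 0 ≤ w τ l :=
  mul_nonneg (by positivity)
    (Finset.prod_nonneg fun i _ => div_nonneg (Real.sqrt_nonneg _) (F_nonneg τ i l))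

lemma measurable_F {k : ℕ} (τ : Equiv.Perm (Fin (k + 1))) (i : Fin k) : Measurable (F τ i) := by
  unfold F; fun_prop

lemma measurable_w {k : ℕ} (τ : Equiv.Perm (Fin (k + 1))) : Measurable (w τ) := by
  have := measurable_F τ
  unfold w; fun_prop

lemma measurable_Qker {k : ℕ} : Measurable (Qker (k := k)) := by
  refine Measure.measurable_of_measurable_coe _ fun s hs => ?_
  simp only [Qker, Measure.coe_finsetSum, Finset.sum_apply, Measure.smul_apply, smul_eq_mul]
  refine Finset.measurable_sum _ fun τ _ => (measurable_w τ).ennreal_ofReal.mul ?_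
  exact (Measure.measurable_coe hs).comp
    (Measure.measurable_dirac.comp (measurable_pi_lambda _ fun i => measurable_F τ i))

lemma w_mul_prod_F {k : ℕ} (τ : Equiv.Perm (Fin (k + 1))) {l x : Fin k → ℝ}
    (hl : ∀ i, 0 < l i) (hx : ∀ i, 0 ≤ x i) :
    w τ l * ∏ i, F τ i l * Real.exp (-(F τ i l * x i))
      = ∏ j : Fin k, 2⁻¹ * (√(2 * l j) *
          Real.exp (-(√(2 * l j) * |xbar x (τ j.succ) - xbar x (τ j.castSucc)|))) := by
  have hF : ∏ i, F τ i l ≠ 0 := Finset.prod_ne_zero_iff.2 fun i _ => (F_pos τ i hl).ne'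
  rw [w]
  simp only [Finset.prod_mul_distrib, Finset.prod_div_distrib, ← Real.exp_sum,
    Finset.sum_neg_distrib, sum_F_mul τ l hx, Finset.prod_const, Finset.card_univ, Fintype.card_fin]
  field_simp

lemma lintegral_Qker {k : ℕ} (l : Fin k → ℝ) {f : (Fin k → ℝ) → ENNReal} (hf : Measurable f) :
    ∫⁻ z, f z ∂(Qker l) = ∑ τ : Equiv.Perm (Fin (k + 1)),
      ENNReal.ofReal (w τ l) * f (fun i => F τ i l) := by
  simp [Qker, lintegral_finsetSum_measure, lintegral_smul_measure, lintegral_dirac' _ hf]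

/-- The density at `x` of a product of exponential laws with parameters `l`. -/
def expDensity {k : ℕ} (l x : Fin k → ℝ) : ℝ := ∏ i, l i * Real.exp (-(l i * x i))

lemma expDensity_nonneg {k : ℕ} {l : Fin k → ℝ} (hl : ∀ i, 0 ≤ l i) (x : Fin k → ℝ) :
    0 ≤ expDensity l x :=
  Finset.prod_nonneg fun i _ => mul_nonneg (hl i) (Real.exp_nonneg _)

lemma measurable_expDensity {k : ℕ} :
    Measurable fun q : (Fin k → ℝ) × (Fin k → ℝ) => expDensity q.1 q.2 := by
  unfold expDensity; fun_prop

lemma measurable_expDensity_left {k : ℕ} (x : Fin k → ℝ) :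
    Measurable fun l => expDensity l x :=
  measurable_expDensity.comp measurable_prodMk_right

lemma Phi_nonneg (g y : ℝ) : 0 ≤ Phi g y := by unfold Phi; positivity

lemma Psi_nonneg {k : ℕ} (g x : Fin k → ℝ) : 0 ≤ Psi g x :=
  Finset.sum_nonneg fun _ _ => Finset.prod_nonneg fun _ _ => Phi_nonneg _ _

lemma measurable_Psi {k : ℕ} (x : Fin k → ℝ) : Measurable fun g => Psi g x := by
  unfold Psi Phi; fun_prop

lemma expDensity_le {k : ℕ} {l x : Fin k → ℝ} (hl : ∀ i, 0 ≤ l i) (hx : ∀ i, 0 < x i) :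
    expDensity l x ≤ ∏ i, (x i)⁻¹ := by
  refine Finset.prod_le_prod (fun i _ => mul_nonneg (hl i) (Real.exp_nonneg _)) fun i _ => ?_
  rw [Real.exp_neg, ← div_eq_mul_inv, div_le_iff₀ (Real.exp_pos _), inv_mul_eq_div,
    le_div_iff₀ (hx i)]
  linarith [Real.add_one_le_exp (l i * x i)]

lemma ofReal_fmix {k : ℕ} {ν : Measure (Fin k → ℝ)} [IsFiniteMeasure ν]
    (hν : ∀ᵐ l ∂ν, ∀ i, 0 ≤ l i) {x : Fin k → ℝ} (hx : ∀ i, 0 < x i) :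
    ENNReal.ofReal (fmix ν x) = ∫⁻ l, ENNReal.ofReal (expDensity l x) ∂ν := by
  have h0 : 0 ≤ᵐ[ν] fun l => expDensity l x := hν.mono fun l hl => expDensity_nonneg hl x
  refine ofReal_integral_eq_lintegral_ofReal (Integrable.of_bound
    (measurable_expDensity_left x).aestronglyMeasurable (∏ i, (x i)⁻¹) ?_) h0
  filter_upwards [hν] with l hl
  exact (Real.norm_of_nonneg (expDensity_nonneg hl x)).trans_le (expDensity_le hl hx)

lemma measurable_fmix {k : ℕ} (ν : Measure (Fin k → ℝ)) [IsFiniteMeasure ν] :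
    Measurable (fmix ν) :=
  (StronglyMeasurable.integral_prod_right (ν := ν)
    (f := fun (x l : Fin k → ℝ) => expDensity l x)
    (measurable_expDensity.comp measurable_swap).stronglyMeasurable).measurable

lemma lintegral_expDensity_mul_Psi {k : ℕ} {l x : Fin k → ℝ}
    (hl : ∀ i, 0 < l i) (hx : ∀ i, 0 < x i) :
    ∫⁻ g in {g : Fin k → ℝ | ∀ i, 0 < g i}, ENNReal.ofReal (expDensity l g * Psi g x)
      = ∫⁻ z, ENNReal.ofReal (expDensity z x) ∂(Qker l) := by
  rw [lintegral_Qker l (measurable_expDensity_left x).ennreal_ofReal]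
  have hset : {g : Fin k → ℝ | ∀ i, 0 < g i} = Set.univ.pi fun _ => Set.Ioi 0 := by
    ext; simp
  have hsum : ∀ g : Fin k → ℝ, ENNReal.ofReal (expDensity l g * Psi g x)
      = ∑ τ : Equiv.Perm (Fin (k + 1)), ENNReal.ofReal (∏ i, l i * Real.exp (-(l i * g i)) *
          Phi (g i) (xbar x (τ i.succ) - xbar x (τ i.castSucc))) := by
    intro g
    rw [expDensity, Psi, Finset.mul_sum, ENNReal.ofReal_sum_of_nonneg]
    · simp only [Finset.prod_mul_distrib]
    · exact fun τ _ => mul_nonneg (expDensity_nonneg (fun i => (hl i).le) g)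
        (Finset.prod_nonneg fun _ _ => Phi_nonneg _ _)
  simp only [hsum]
  rw [lintegral_finsetSum]
  swap
  · intro τ _
    unfold Phi; fun_prop
  refine Finset.sum_congr rfl fun τ _ => ?_
  have hne : ∀ i : Fin k, xbar x (τ i.succ) - xbar x (τ i.castSucc) ≠ 0 := fun i h =>
    (Fin.castSucc_lt_succ (i := i)).ne'
      (τ.injective ((xbar_strictMono hx).injective (sub_eq_zero.1 h)))
  rw [← ENNReal.ofReal_mul (w_nonneg τ l), expDensity, w_mul_prod_F τ hl fun i => (hx i).le,
    hset, volume_pi, Measure.restrict_pi_pi, ← ofReal_integral_eq_lintegral_ofReal,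
    integral_fintype_prod_eq_prod (fun i g => l i * Real.exp (-(l i * g)) *
      Phi g (xbar x (τ i.succ) - xbar x (τ i.castSucc)))]
  · simp only [(integral_exp_mul_Phi (hl _) (hne _)).2]
  · exact Integrable.fintype_prod fun i => (integral_exp_mul_Phi (hl i) (hne i)).1
  · exact .of_forall fun g => Finset.prod_nonneg fun i _ =>
      mul_nonneg (mul_nonneg (hl i).le (Real.exp_nonneg _)) (Phi_nonneg _ _)

lemma measurableSet_pos {k : ℕ} : MeasurableSet {l : Fin k → ℝ | ∀ i, 0 < l i} := by
  simp only [Set.ofPred_forall]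
  exact .iInter fun i => measurableSet_lt measurable_const (measurable_pi_apply i)

lemma ae_pos_of_measure_eq_one {k : ℕ} {ν : Measure (Fin k → ℝ)} [IsProbabilityMeasure ν]
    (hν : ν {l : Fin k → ℝ | ∀ i, 0 < l i} = 1) : ∀ᵐ l ∂ν, ∀ i, 0 < l i :=
  (prob_compl_eq_zero_iff measurableSet_pos).2 hν

/-- the gaps operator of iterated Brownian motion maps the mixture of
products of exponential densities with parameter law `ν` to the mixture with
parameter law `νQ`. -/
theorem stmt8 {k : ℕ} (hk : 1 ≤ k) (ν : Measure (Fin k → ℝ)) [IsProbabilityMeasure ν]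
    (hν : ν {l : Fin k → ℝ | ∀ i, 0 < l i} = 1)
    (x : Fin k → ℝ) (hx : ∀ i, 0 < x i) :
    ∫ g in {g : Fin k → ℝ | ∀ i, 0 < g i}, fmix ν g * Psi g x = fmix (ν.bind Qker) x := by
  have hpos := ae_pos_of_measure_eq_one hν
  have hnn : ∀ᵐ l ∂ν, ∀ i, 0 ≤ l i := hpos.mono fun l hl i => (hl i).le
  have hmQ := measurable_Qker (k := k)
  have hmx := measurable_expDensity_left x
  have hbind : ∀ᵐ z ∂ν.bind Qker, ∀ i, 0 ≤ z i := by
    have hm : MeasurableSet {z : Fin k → ℝ | ∀ i, 0 ≤ z i}ᶜ := by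
      simp only [Set.ofPred_forall]
      exact (MeasurableSet.iInter fun i =>
        measurableSet_le measurable_const (measurable_pi_apply i)).compl
    rw [ae_iff]
    change ν.bind Qker {z : Fin k → ℝ | ∀ i, 0 ≤ z i}ᶜ = 0
    rw [Measure.bind_apply hm hmQ.aemeasurable]
    simp [Qker, Measure.dirac_apply' _ hm, F_nonneg]
  have hfmix_nonneg : ∀ g, 0 ≤ fmix ν g := fun g =>
    integral_nonneg_of_ae (hnn.mono fun l hl => expDensity_nonneg hl g)
  rw [integral_eq_lintegral_of_nonneg_ae
      (.of_forall fun g => mul_nonneg (hfmix_nonneg g) (Psi_nonneg g x))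
      ((measurable_fmix ν).mul (measurable_Psi x)).aestronglyMeasurable]
  change _ = ∫ z, expDensity z x ∂ν.bind Qker
  rw [integral_eq_lintegral_of_nonneg_ae (hbind.mono fun z hz => expDensity_nonneg hz x)
      hmx.aestronglyMeasurable]
  congr 1
  rw [Measure.lintegral_bind hmQ.aemeasurable hmx.ennreal_ofReal.aemeasurable]
  calc ∫⁻ g in {g : Fin k → ℝ | ∀ i, 0 < g i}, ENNReal.ofReal (fmix ν g * Psi g x)
      = ∫⁻ g in {g : Fin k → ℝ | ∀ i, 0 < g i},
          ∫⁻ l, ENNReal.ofReal (expDensity l g * Psi g x) ∂ν := by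
        refine setLIntegral_congr_fun measurableSet_pos fun g hg => ?_
        simp only [ENNReal.ofReal_mul' (Psi_nonneg g x)]
        rw [ofReal_fmix hnn hg, lintegral_mul_const]
        exact (measurable_expDensity_left g).ennreal_ofReal
    _ = ∫⁻ l, (∫⁻ g in {g : Fin k → ℝ | ∀ i, 0 < g i},
          ENNReal.ofReal (expDensity l g * Psi g x)) ∂ν := by
        refine lintegral_lintegral_swap (Measurable.aemeasurable ?_)
        exact ((measurable_expDensity.comp measurable_swap).mul
          ((measurable_Psi x).comp measurable_fst)).ennreal_ofReal
    _ = _ := lintegral_congr_ae (hpos.mono fun l hl => lintegral_expDensity_mul_Psi hl hx)
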